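/- Let F be an infinite field, and let Λ₁ ⊆ I₁ × J₁ × K₁, …, Λ_p ⊆ I_p × J_p × K_p be nonempty patterns over finite sets. Then Σ_{i=1}^p |Λ_i|^{ω_s/3} ≤ Ř_s(Φ(Λ₁) + ⋯ + Φ(Λ_p)), where Φ(Λ₁) + ⋯ + Φ(Λ_p) is the block-diagonal direct sum of the partial matrix multiplication supports. -/

import Mathlib

open scoped BigOperators

/-- The rank of a tensor `t : I × J × K → F`. -/
noncomputable def TensorRank (F : Type*) [Field F] {I J K : Type*} (t : I × J × K → F) : ℕ :=
  sInf {L : ℕ | ∃ (a : Fin L → I → F) (b : Fin L → J → F) (c : Fin L → K → F),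
    ∀ q : I × J × K, t q = ∑ m, a m q.1 * b m q.2.1 * c m q.2.2}

/-- The support rank of `Φ ⊆ I × J × K`. -/
noncomputable def SupportRank (F : Type*) [Field F] {I J K : Type*} (Φ : Set (I × J × K)) : ℕ :=
  sInf (TensorRank F '' {t : I × J × K → F | {q | t q ≠ 0} = Φ})

/-- The `n`-fold product `Φ^{×n}` of a support `Φ ⊆ I × J × K`. -/
def PowSupport {I J K : Type*} (Φ : Set (I × J × K)) (n : ℕ) :
    Set ((Fin n → I) × (Fin n → J) × (Fin n → K)) :=
  {q | ∀ s : Fin n, (q.1 s, q.2.1 s, q.2.2 s) ∈ Φ}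

/-- The asymptotic support rank `Ř_s(Φ) = inf_{n ≥ 1} R_s(Φ^{×n})^{1/n}`. -/
noncomputable def AsymptoticSupportRank (F : Type*) [Field F] {I J K : Type*}
    (Φ : Set (I × J × K)) : ℝ :=
  sInf {x : ℝ | ∃ n : ℕ, 0 < n ∧
    x = (SupportRank F (PowSupport Φ n) : ℝ) ^ ((1 : ℝ) / n)}

/-- The support of the `l × m × n` matrix multiplication tensor. -/
def MMSupport (l m n : ℕ) :
    Set ((Fin l × Fin m) × (Fin m × Fin n) × (Fin n × Fin l)) :=
  {q | ∃ i j k, q = ((i, j), (j, k), (k, i))}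

/-- The rectangular support rank exponent `ω_s(a,b,c)`. -/
noncomputable def omegaS (F : Type*) [Field F] (a b c : ℝ) : ℝ :=
  Filter.limsup (fun n : ℕ =>
    (1 / n : ℝ) * Real.logb 2
      (SupportRank F (MMSupport ⌊(2 : ℝ) ^ (a * n)⌋₊ ⌊(2 : ℝ) ^ (b * n)⌋₊
        ⌊(2 : ℝ) ^ (c * n)⌋₊))) Filter.atTop

/-- The block-diagonal direct sum `Φ(Λ₁) + ⋯ + Φ(Λ_p)` of the partial matrix
multiplication supports of a family of patterns. -/
def FamPMMSumSupport {p : ℕ} {I J K : Fin p → Type*}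
    (Λ : ∀ i, Set (I i × J i × K i)) :
    Set ((Σ i, I i × J i) × (Σ i, J i × K i) × (Σ i, K i × I i)) :=
  {q | ∃ (i : Fin p) (x : I i) (y : J i) (z : K i), (x, y, z) ∈ Λ i ∧
    q = (⟨i, (x, y)⟩, ⟨i, (y, z)⟩, ⟨i, (z, x)⟩)}

section RankCalculus

variable {F : Type*} [Field F] {X Y Z X' Y' Z' : Type*}

/-- The tensor `t` is a sum of `L` rank-one tensors. -/
def RankLE (t : X → Y → Z → F) (L : ℕ) : Prop :=
  ∃ (a : Fin L → X → F) (b : Fin L → Y → F) (c : Fin L → Z → F),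
    ∀ x y z, t x y z = ∑ m, a m x * b m y * c m z

theorem RankLE.of_fintype {ι : Type*} [Fintype ι] {t : X → Y → Z → F} {L : ℕ}
    (hL : Fintype.card ι = L) (a : ι → X → F) (b : ι → Y → F) (c : ι → Z → F)
    (h : ∀ x y z, t x y z = ∑ m, a m x * b m y * c m z) : RankLE t L := by
  subst hL
  let e := (Fintype.equivFin ι).symm
  refine ⟨fun m => a (e m), fun m => b (e m), fun m => c (e m), fun x y z => ?_⟩
  rw [h]
  exact (e.sum_comp (fun m => a m x * b m y * c m z)).symm

theorem RankLE.comap {t : X → Y → Z → F} {L : ℕ} (h : RankLE t L)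
    (f : X' → X) (g : Y' → Y) (k : Z' → Z) :
    RankLE (fun x y z => t (f x) (g y) (k z)) L := by
  obtain ⟨a, b, c, h⟩ := h
  exact ⟨fun m x => a m (f x), fun m y => b m (g y), fun m z => c m (k z),
    fun x y z => h _ _ _⟩

theorem RankLE.rotate {t : X → Y → Z → F} {L : ℕ} (h : RankLE t L) :
    RankLE (fun y z x => t x y z) L := by
  obtain ⟨a, b, c, h⟩ := h
  exact ⟨b, c, a, fun y z x =>
    (h x y z).trans (Finset.sum_congr rfl fun m _ => by ring)⟩

theorem RankLE.mul {t : X → Y → Z → F} {u : X → Y → Z → F} {L L' : ℕ}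
    (h : RankLE t L) (h' : RankLE u L') :
    RankLE (fun x y z => t x y z * u x y z) (L * L') := by
  obtain ⟨a, b, c, h⟩ := h
  obtain ⟨a', b', c', h'⟩ := h'
  refine RankLE.of_fintype (ι := Fin L × Fin L') (by simp)
    (fun m x => a m.1 x * a' m.2 x) (fun m y => b m.1 y * b' m.2 y)
    (fun m z => c m.1 z * c' m.2 z) fun x y z => ?_
  rw [h, h', Finset.sum_mul_sum, ← Finset.univ_product_univ, Finset.sum_product]
  exact Finset.sum_congr rfl fun m _ => Finset.sum_congr rfl fun m' _ => by ring

theorem RankLE.add_smul {t : X → Y → Z → F} {u : X → Y → Z → F} {L L' : ℕ}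
    (h : RankLE t L) (h' : RankLE u L') (r : F) :
    RankLE (fun x y z => t x y z + r * u x y z) (L + L') := by
  obtain ⟨a, b, c, h⟩ := h
  obtain ⟨a', b', c', h'⟩ := h'
  refine RankLE.of_fintype (ι := Fin L ⊕ Fin L') (by simp)
    (Sum.elim a fun m x => r * a' m x) (Sum.elim b b') (Sum.elim c c') fun x y z => ?_
  rw [h, h', Fintype.sum_sum_type, Finset.mul_sum]
  simp [mul_assoc]

theorem RankLE.prod {n : ℕ} {t : X → Y → Z → F} {L : ℕ} (h : RankLE t L) :
    RankLE (fun (x : Fin n → X) (y : Fin n → Y) (z : Fin n → Z) =>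
      ∏ s, t (x s) (y s) (z s)) (L ^ n) := by
  obtain ⟨a, b, c, h⟩ := h
  refine RankLE.of_fintype (ι := Fin n → Fin L) (by simp)
    (fun m x => ∏ s, a (m s) (x s)) (fun m y => ∏ s, b (m s) (y s))
    (fun m z => ∏ s, c (m s) (z s)) fun x y z => ?_
  simp only [h, Finset.prod_univ_sum, Fintype.piFinset_univ, Finset.prod_mul_distrib]

open Classical in
theorem RankLE.map [Fintype X] [Fintype Y] [Fintype Z] {t : X → Y → Z → F} {L : ℕ}
    (h : RankLE t L) (f : X → X') (g : Y → Y') (k : Z → Z')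
    (α : X → F) (β : Y → F) (γ : Z → F) :
    RankLE (fun x' y' z' => ∑ q : X × Y × Z,
      if f q.1 = x' ∧ g q.2.1 = y' ∧ k q.2.2 = z' then
        t q.1 q.2.1 q.2.2 * (α q.1 * β q.2.1 * γ q.2.2) else 0) L := by
  obtain ⟨a, b, c, h⟩ := h
  refine ⟨fun m x' => ∑ x, if f x = x' then a m x * α x else 0,
    fun m y' => ∑ y, if g y = y' then b m y * β y else 0,
    fun m z' => ∑ z, if k z = z' then c m z * γ z else 0, fun x' y' z' => ?_⟩
  have key : ∀ m, (∑ x, if f x = x' then a m x * α x else 0) *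
      (∑ y, if g y = y' then b m y * β y else 0) *
      (∑ z, if k z = z' then c m z * γ z else 0) =
      ∑ q : X × Y × Z, if f q.1 = x' ∧ g q.2.1 = y' ∧ k q.2.2 = z' then
        a m q.1 * b m q.2.1 * c m q.2.2 * (α q.1 * β q.2.1 * γ q.2.2) else 0 := by
    intro m
    rw [mul_assoc, Finset.sum_mul_sum, Finset.sum_mul_sum, Fintype.sum_prod_type]
    refine Finset.sum_congr rfl fun x _ => ?_
    rw [Fintype.sum_prod_type]
    refine Finset.sum_congr rfl fun y _ => ?_
    rw [Finset.mul_sum]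
    refine Finset.sum_congr rfl fun z _ => ?_
    by_cases h1 : f x = x' <;> by_cases h2 : g y = y' <;> by_cases h3 : k z = z' <;>
      simp [h1, h2, h3]
    ring
  simp only [key]
  rw [Finset.sum_comm]
  refine Finset.sum_congr rfl fun q _ => ?_
  split_ifs
  · rw [h, Finset.sum_mul]
  · simp

variable (F) in
/-- Some tensor with support `Φ` is a sum of `L` rank-one tensors. -/
def SuppRankLE (Φ : Set (X × Y × Z)) (L : ℕ) : Prop :=
  ∃ t : X → Y → Z → F, RankLE t L ∧ ∀ x y z, t x y z ≠ 0 ↔ (x, y, z) ∈ Φ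

theorem supportRank_le {Φ : Set (X × Y × Z)} {L : ℕ} (h : SuppRankLE F Φ L) :
    SupportRank F Φ ≤ L := by
  obtain ⟨t, ⟨a, b, c, ht⟩, hΦ⟩ := h
  have h1 : SupportRank F Φ ≤ TensorRank F fun q : X × Y × Z => t q.1 q.2.1 q.2.2 :=
    Nat.sInf_le ⟨_, by ext ⟨x, y, z⟩; exact hΦ x y z, rfl⟩
  exact h1.trans (Nat.sInf_le ⟨a, b, c, fun q => ht _ _ _⟩)

open Classical in
theorem suppRankLE_supportRank [Fintype X] [Fintype Y] [Fintype Z] (Φ : Set (X × Y × Z)) :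
    SuppRankLE F Φ (SupportRank F Φ) := by
  have hne : (TensorRank F '' {t : X × Y × Z → F | {q | t q ≠ 0} = Φ}).Nonempty :=
    ⟨_, fun q => if q ∈ Φ then 1 else 0, by ext q; simp, rfl⟩
  obtain ⟨t, ht, hr⟩ := Nat.sInf_mem hne
  have hne' : {L : ℕ | ∃ (a : Fin L → X → F) (b : Fin L → Y → F) (c : Fin L → Z → F),
      ∀ q : X × Y × Z, t q = ∑ m, a m q.1 * b m q.2.1 * c m q.2.2}.Nonempty := by
    obtain ⟨a, b, c, h⟩ := RankLE.of_fintype (ι := X × Y × Z)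
      (t := fun x y z => t (x, y, z)) rfl
      (fun q x => if x = q.1 then t q else 0) (fun q y => if y = q.2.1 then 1 else 0)
      (fun q z => if z = q.2.2 then 1 else 0) (fun x y z => by
        rw [Finset.sum_eq_single (x, y, z)]
        · simp
        · rintro ⟨x', y', z'⟩ - hq
          by_cases h1 : x = x' <;> by_cases h2 : y = y' <;> by_cases h3 : z = z' <;>
            simp_all
        · simp)
    exact ⟨_, a, b, c, fun q => h _ _ _⟩
  obtain ⟨a, b, c, h⟩ := Nat.sInf_mem hne'
  have hr' : SupportRank F Φ = sInf {L : ℕ | ∃ (a : Fin L → X → F) (b : Fin L → Y → F)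
      (c : Fin L → Z → F), ∀ q : X × Y × Z, t q = ∑ m, a m q.1 * b m q.2.1 * c m q.2.2} :=
    hr.symm
  rw [hr']
  refine ⟨fun x y z => t (x, y, z), ⟨a, b, c, fun x y z => h (x, y, z)⟩, fun x y z => ?_⟩
  exact Set.ext_iff.mp ht (x, y, z)

theorem SuppRankLE.comap {Φ : Set (X × Y × Z)} {L : ℕ} (h : SuppRankLE F Φ L)
    (f : X' → X) (g : Y' → Y) (k : Z' → Z) {Ψ : Set (X' × Y' × Z')}
    (hΨ : ∀ x y z, (f x, g y, k z) ∈ Φ ↔ (x, y, z) ∈ Ψ) : SuppRankLE F Ψ L := by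
  obtain ⟨t, ht, hΦ⟩ := h
  exact ⟨_, ht.comap f g k, fun x y z => (hΦ _ _ _).trans (hΨ x y z)⟩

theorem SuppRankLE.pow {Φ : Set (X × Y × Z)} {L : ℕ} (h : SuppRankLE F Φ L) (n : ℕ) :
    SuppRankLE F (PowSupport Φ n) (L ^ n) := by
  obtain ⟨t, ht, hΦ⟩ := h
  refine ⟨_, ht.prod, fun x y z => ?_⟩
  simp only [ne_eq, Finset.prod_eq_zero_iff, Finset.mem_univ, true_and, not_exists]
  exact forall_congr' fun s => hΦ _ _ _

theorem SuppRankLE.empty : SuppRankLE F (∅ : Set (X × Y × Z)) 0 :=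
  ⟨fun _ _ _ => 0, ⟨fun _ _ => 0, fun _ _ => 0, fun _ _ => 0, by simp⟩, by simp⟩

theorem SuppRankLE.union [Infinite F] [Finite X] [Finite Y] [Finite Z]
    {Φ Ψ : Set (X × Y × Z)} {L L' : ℕ}
    (h : SuppRankLE F Φ L) (h' : SuppRankLE F Ψ L') : SuppRankLE F (Φ ∪ Ψ) (L + L') := by
  obtain ⟨t, ht, hΦ⟩ := h
  obtain ⟨u, hu, hΨ⟩ := h'
  obtain ⟨r, hr⟩ := (((Set.finite_range fun q : X × Y × Z =>
    -t q.1 q.2.1 q.2.2 / u q.1 q.2.1 q.2.2).union (Set.finite_singleton 0))).exists_notMem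
  simp only [Set.mem_union, Set.mem_range, Set.mem_singleton_iff, not_or, not_exists] at hr
  refine ⟨_, ht.add_smul hu r, fun x y z => ?_⟩
  have h1 := hΦ x y z
  have h2 := hΨ x y z
  have h3 := hr.1 (x, y, z)
  rw [Set.mem_union, ← h1, ← h2]
  by_cases hu0 : u x y z = 0
  · simp [hu0]
  · simp only [ne_eq, hu0, not_false_eq_true, or_true, iff_true]
    intro h0
    apply h3
    simp only
    rw [div_eq_iff hu0]
    linear_combination -h0

theorem SuppRankLE.iUnion [Infinite F] [Finite X] [Finite Y] [Finite Z] {ι : Type*} [Fintype ι]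
    {Φ : ι → Set (X × Y × Z)} {L : ℕ} (h : ∀ i, SuppRankLE F (Φ i) L) :
    SuppRankLE F (⋃ i, Φ i) (Fintype.card ι * L) := by
  classical
  have key : ∀ S : Finset ι, SuppRankLE F (⋃ i ∈ S, Φ i) (S.card * L) := by
    intro S
    induction S using Finset.induction_on with
    | empty => simpa using SuppRankLE.empty
    | insert a S ha ih =>
      rw [Finset.card_insert_of_notMem ha, Finset.set_biUnion_insert, add_mul, one_mul, add_comm]
      exact (h a).union ih
  simpa using key Finset.univ

/-- Identifying variables does not increase the support rank over an infinite field: scaling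
the variables by suitable powers of one scalar avoids all cancellations. -/
theorem SuppRankLE.image [Infinite F] [Fintype X] [Fintype Y] [Fintype Z] [Finite X'] [Finite Y']
    [Finite Z'] {Φ : Set (X × Y × Z)} {L : ℕ} (h : SuppRankLE F Φ L)
    (f : X → X') (g : Y → Y') (k : Z → Z') :
    SuppRankLE F (Prod.map f (Prod.map g k) '' Φ) L := by
  classical
  obtain ⟨t, ht, hΦ⟩ := h
  let nX := Fintype.card X
  let nY := Fintype.card Y
  let eX : X → ℕ := fun x => Fintype.equivFin X x
  let eY : Y → ℕ := fun y => Fintype.equivFin Y y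
  let eZ : Z → ℕ := fun z => Fintype.equivFin Z z
  let e : X × Y × Z → ℕ := fun q => eX q.1 + nX * eY q.2.1 + nX * nY * eZ q.2.2
  have he : Function.Injective e := by
    rintro ⟨x, y, z⟩ ⟨x', y', z'⟩ hq
    have hx : eX x < nX := (Fintype.equivFin X x).2
    have hx' : eX x' < nX := (Fintype.equivFin X x').2
    have hy : eY y < nY := (Fintype.equivFin Y y).2
    have hy' : eY y' < nY := (Fintype.equivFin Y y').2
    have hq1 : eX x + nX * (eY y + nY * eZ z) = eX x' + nX * (eY y' + nY * eZ z') := by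
      simp only [e] at hq
      linarith
    have h1 : eX x = eX x' := by
      have := congrArg (· % nX) hq1
      simpa [Nat.add_mul_mod_self_left, Nat.mod_eq_of_lt hx, Nat.mod_eq_of_lt hx'] using this
    have hq2 : eY y + nY * eZ z = eY y' + nY * eZ z' := by
      rw [h1] at hq1
      exact Nat.eq_of_mul_eq_mul_left (by omega) (Nat.add_left_cancel hq1)
    have h2 : eY y = eY y' := by
      have := congrArg (· % nY) hq2
      simpa [Nat.add_mul_mod_self_left, Nat.mod_eq_of_lt hy, Nat.mod_eq_of_lt hy'] using this
    have h3 : eZ z = eZ z' := by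
      rw [h2] at hq2
      exact Nat.eq_of_mul_eq_mul_left (by omega) (Nat.add_left_cancel hq2)
    have i1 := (Fintype.equivFin X).injective (Fin.ext h1)
    have i2 := (Fintype.equivFin Y).injective (Fin.ext h2)
    have i3 := (Fintype.equivFin Z).injective (Fin.ext h3)
    rw [i1, i2, i3]
  let P : X' × Y' × Z' → Polynomial F := fun q' => ∑ q : X × Y × Z,
    if f q.1 = q'.1 ∧ g q.2.1 = q'.2.1 ∧ k q.2.2 = q'.2.2 then
      Polynomial.monomial (e q) (t q.1 q.2.1 q.2.2) else 0
  have hP : ∀ q', P q' ≠ 0 ↔ q' ∈ Prod.map f (Prod.map g k) '' Φ := by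
    rintro ⟨x', y', z'⟩
    constructor
    · intro h0
      obtain ⟨⟨x, y, z⟩, -, hq⟩ := Finset.exists_ne_zero_of_sum_ne_zero h0
      by_cases hc : f x = x' ∧ g y = y' ∧ k z = z'
      · obtain ⟨rfl, rfl, rfl⟩ := hc
        refine ⟨(x, y, z), (hΦ x y z).1 fun h1 => hq ?_, rfl⟩
        simp [h1]
      · exact absurd (if_neg hc) hq
    · rintro ⟨⟨x, y, z⟩, hq, heq⟩ h0
      simp only [Prod.map_apply, Prod.mk.injEq] at heq
      obtain ⟨rfl, rfl, rfl⟩ := heq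
      apply (hΦ x y z).2 hq
      have := congrArg (fun p => Polynomial.coeff p (e (x, y, z))) h0
      simp only [P, Polynomial.finsetSum_coeff, Polynomial.coeff_zero] at this
      rw [Finset.sum_eq_single (x, y, z)] at this
      · simpa using this
      · intro q _ hne
        split_ifs
        · rw [Polynomial.coeff_monomial, if_neg fun hh => hne (he hh)]
        · simp
      · simp
  have hfin : (⋃ q' : X' × Y' × Z', {r | P q' ≠ 0 ∧ (P q').IsRoot r}).Finite := by
    refine Set.finite_iUnion fun q' => ?_
    by_cases h0 : P q' = 0
    · simp [h0]
    · exact (Polynomial.finite_setOfPred_isRoot h0).subset fun r hr => hr.2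
  obtain ⟨r, hr⟩ := hfin.exists_notMem
  simp only [Set.mem_iUnion, Set.mem_ofPred_eq, not_exists, not_and] at hr
  refine ⟨_, ht.map f g k (fun x => r ^ eX x) (fun y => r ^ (nX * eY y))
    (fun z => r ^ (nX * nY * eZ z)), fun x' y' z' => ?_⟩
  rw [← hP]
  have heval : (P (x', y', z')).eval r = ∑ q : X × Y × Z,
      if f q.1 = x' ∧ g q.2.1 = y' ∧ k q.2.2 = z' then
        t q.1 q.2.1 q.2.2 * (r ^ eX q.1 * r ^ (nX * eY q.2.1) * r ^ (nX * nY * eZ q.2.2))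
      else 0 := by
    simp only [P, Polynomial.eval_finsetSum]
    refine Finset.sum_congr rfl fun q _ => ?_
    split_ifs
    · rw [Polynomial.eval_monomial, ← pow_add, ← pow_add]
    · simp
  rw [← heval]
  refine ⟨fun h1 h2 => h1 (by simp [h2]), fun h1 h2 => hr _ h1 h2⟩

end RankCalculus

section MatrixMultiplication

variable {F : Type*} [Field F] {I J K : Type*}

/-- The partial matrix multiplication support `Φ(Λ)` of a pattern `Λ`. -/
def pmmSupport (Λ : Set (I × J × K)) : Set ((I × J) × (J × K) × (K × I)) :=
  {q | q.1.2 = q.2.1.1 ∧ q.2.1.2 = q.2.2.1 ∧ q.2.2.2 = q.1.1 ∧ (q.1.1, q.1.2, q.2.1.2) ∈ Λ}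

theorem mem_pmmSupport {Λ : Set (I × J × K)} {i i' : I} {j j' : J} {k k' : K} :
    ((i, j), (j', k), (k', i')) ∈ pmmSupport Λ ↔ j = j' ∧ k = k' ∧ i' = i ∧ (i, j, k) ∈ Λ :=
  Iff.rfl

theorem MMSupport_eq (l m n : ℕ) : MMSupport l m n = pmmSupport Set.univ := by
  ext ⟨⟨i, j⟩, ⟨j', k⟩, ⟨k', i'⟩⟩
  simp only [MMSupport, mem_pmmSupport, Set.mem_ofPred_eq, Set.mem_univ, and_true, Prod.mk.injEq]
  constructor
  · rintro ⟨a, b, c, ⟨rfl, rfl⟩, ⟨rfl, rfl⟩, rfl, rfl⟩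
    simp
  · rintro ⟨rfl, rfl, rfl⟩
    simp

theorem mem_MMSupport {l m n : ℕ} {i i' : Fin l} {j j' : Fin m} {k k' : Fin n} :
    ((i, j), (j', k), (k', i')) ∈ MMSupport l m n ↔ j = j' ∧ k = k' ∧ i' = i := by
  simp [MMSupport_eq, mem_pmmSupport]

theorem SuppRankLE.pmm_of_injective {I' J' K' : Type*} {Λ : Set (I × J × K)} {L : ℕ}
    (h : SuppRankLE F (pmmSupport Λ) L) (f : I' → I) (g : J' → J) (k : K' → K)
    (hf : Function.Injective f) (hg : Function.Injective g) (hk : Function.Injective k)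
    {Λ' : Set (I' × J' × K')} (hΛ : ∀ x y z, (f x, g y, k z) ∈ Λ ↔ (x, y, z) ∈ Λ') :
    SuppRankLE F (pmmSupport Λ') L := by
  refine h.comap (Prod.map f g) (Prod.map g k) (Prod.map k f) ?_
  rintro ⟨i, j⟩ ⟨j', c⟩ ⟨c', i'⟩
  simp only [Prod.map_apply, mem_pmmSupport, hf.eq_iff, hg.eq_iff, hk.eq_iff, hΛ]

theorem SuppRankLE.MMSupport_mono {l l' : ℕ} (hl : l' ≤ l) {L : ℕ}
    (h : SuppRankLE F (MMSupport l l l) L) : SuppRankLE F (MMSupport l' l' l') L := by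
  rw [MMSupport_eq] at *
  have hi := Fin.castLE_injective hl
  exact h.pmm_of_injective _ _ _ hi hi hi (by simp)

/-- The pattern of all words whose letters at position `s` lie in `Λ s`. -/
def piPattern {n : ℕ} (Λ : Fin n → Set (I × J × K)) :
    Set ((Fin n → I) × (Fin n → J) × (Fin n → K)) :=
  {q | ∀ s, (q.1 s, q.2.1 s, q.2.2 s) ∈ Λ s}

theorem ncard_piPattern {n : ℕ} (Λ : Fin n → Set (I × J × K)) :
    (piPattern Λ).ncard = ∏ s, (Λ s).ncard := by
  have e : piPattern Λ ≃ ∀ s, Λ s :=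
    { toFun := fun q s => ⟨(q.1.1 s, q.1.2.1 s, q.1.2.2 s), q.2 s⟩
      invFun := fun v => ⟨(fun s => (v s).1.1, fun s => (v s).1.2.1, fun s => (v s).1.2.2),
        fun s => (v s).2⟩
      left_inv := fun _ => rfl
      right_inv := fun _ => rfl }
  simp only [← Nat.card_coe_set_eq]
  rw [Nat.card_congr e, Nat.card_pi]

theorem unzip_mem_pow_pmmSupport {n : ℕ} {Λ : Set (I × J × K)}
    (x : (Fin n → I) × (Fin n → J)) (y : (Fin n → J) × (Fin n → K))
    (z : (Fin n → K) × (Fin n → I)) :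
    ((fun s => (x.1 s, x.2 s), fun s => (y.1 s, y.2 s), fun s => (z.1 s, z.2 s)) ∈
      PowSupport (pmmSupport Λ) n) ↔ (x, y, z) ∈ pmmSupport (piPattern fun _ : Fin n => Λ) := by
  obtain ⟨i, j⟩ := x
  obtain ⟨j', k⟩ := y
  obtain ⟨k', i'⟩ := z
  simp only [PowSupport, Set.mem_ofPred_eq, mem_pmmSupport, piPattern, funext_iff, forall_and]

theorem SuppRankLE.pmm_pow {Λ : Set (I × J × K)} {L : ℕ}
    (h : SuppRankLE F (pmmSupport Λ) L) (n : ℕ) :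
    SuppRankLE F (pmmSupport (piPattern fun _ : Fin n => Λ)) (L ^ n) :=
  (h.pow n).comap (fun x s => (x.1 s, x.2 s)) (fun y s => (y.1 s, y.2 s))
    (fun z s => (z.1 s, z.2 s)) unzip_mem_pow_pmmSupport

theorem SuppRankLE.MMSupport_pow {l L : ℕ} (h : SuppRankLE F (MMSupport l l l) L) (n : ℕ) :
    SuppRankLE F (MMSupport (l ^ n) (l ^ n) (l ^ n)) (L ^ n) := by
  rw [MMSupport_eq] at *
  have e : Fin (l ^ n) ≃ (Fin n → Fin l) := Fintype.equivOfCardEq (by simp)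
  exact (h.pmm_pow n).pmm_of_injective e e e e.injective e.injective e.injective
    (by simp [piPattern])

theorem SuppRankLE.MMSupport_symm {A B C L : ℕ} (h : SuppRankLE F (MMSupport A B C) L) :
    SuppRankLE F (MMSupport (A * B * C) (A * B * C) (A * B * C)) (L ^ 3) := by
  obtain ⟨t, ht, hs⟩ := h
  let e : Fin (A * B * C) ≃ Fin A × Fin B × Fin C :=
    Fintype.equivOfCardEq (by simp [mul_assoc])
  let e' : Fin (A * B * C) ≃ Fin B × Fin C × Fin A :=
    Fintype.equivOfCardEq (by simp; ring)
  let e'' : Fin (A * B * C) ≃ Fin C × Fin A × Fin B :=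
    Fintype.equivOfCardEq (by simp; ring)
  let N := Fin (A * B * C)
  have h1 := ht.comap (fun x : N × N => ((e x.1).1, (e' x.2).1))
    (fun y : N × N => ((e' y.1).1, (e'' y.2).1)) (fun z : N × N => ((e'' z.1).1, (e z.2).1))
  have h2 := (ht.comap (fun z : N × N => ((e'' z.1).2.1, (e z.2).2.1))
    (fun x : N × N => ((e x.1).2.1, (e' x.2).2.1))
    (fun y : N × N => ((e' y.1).2.1, (e'' y.2).2.1))).rotate
  have h3 := (ht.comap (fun y : N × N => ((e' y.1).2.2, (e'' y.2).2.2))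
    (fun z : N × N => ((e'' z.1).2.2, (e z.2).2.2))
    (fun x : N × N => ((e x.1).2.2, (e' x.2).2.2))).rotate.rotate
  refine ⟨_, by simpa [pow_succ] using (h1.mul h2).mul h3, ?_⟩
  rintro ⟨i, j⟩ ⟨j', k⟩ ⟨k', i'⟩
  rw [mem_MMSupport, ← e'.injective.eq_iff, ← e''.injective.eq_iff, ← e.injective.eq_iff]
  simp only [mul_ne_zero_iff, hs, mem_MMSupport, Prod.ext_iff]
  grind

theorem one_le_of_suppRankLE {X Y Z : Type*} {Φ : Set (X × Y × Z)} (hΦ : Φ.Nonempty) {L : ℕ}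
    (h : SuppRankLE F Φ L) : 1 ≤ L := by
  obtain ⟨t, ⟨a, b, c, ht⟩, hs⟩ := h
  obtain ⟨⟨x, y, z⟩, hq⟩ := hΦ
  by_contra hL
  obtain rfl : L = 0 := by omega
  exact (hs x y z).2 hq (by simp [ht])

variable (F) in
/-- An upper bound for the sequence whose limit superior is `ω_s`. -/
theorem omegaS_sequence_le {l L : ℕ} (hl : 2 ≤ l) (h : SuppRankLE F (MMSupport l l l) L)
    {n : ℕ} (hn : 0 < n) :
    (1 / n : ℝ) * Real.logb 2 (SupportRank F (MMSupport ⌊(2 : ℝ) ^ ((1 : ℝ) * n)⌋₊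
      ⌊(2 : ℝ) ^ ((1 : ℝ) * n)⌋₊ ⌊(2 : ℝ) ^ ((1 : ℝ) * n)⌋₊)) ≤
      Real.logb 2 L / Real.logb 2 l + Real.logb 2 L / n := by
  have hfl : ⌊(2 : ℝ) ^ ((1 : ℝ) * n)⌋₊ = 2 ^ n := by
    rw [one_mul, Real.rpow_natCast]
    exact_mod_cast Nat.floor_natCast (2 ^ n)
  rw [hfl]
  have hl1 : (1 : ℝ) < l := by exact_mod_cast hl
  have hlog : 0 < Real.logb 2 l := Real.logb_pos one_lt_two hl1
  have hL : 1 ≤ L := one_le_of_suppRankLE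
    ⟨((⟨0, by omega⟩, ⟨0, by omega⟩), (⟨0, by omega⟩, ⟨0, by omega⟩), (⟨0, by omega⟩, ⟨0, by omega⟩)),
      mem_MMSupport.2 ⟨rfl, rfl, rfl⟩⟩ h
  have hLr : (1 : ℝ) ≤ L := by exact_mod_cast hL
  have hlogL : 0 ≤ Real.logb 2 L := Real.logb_nonneg one_lt_two hLr
  have hn' : (0 : ℝ) < n := by exact_mod_cast hn
  set k := ⌈(n : ℝ) / Real.logb 2 l⌉₊ with hk
  have hk1 : (n : ℝ) / Real.logb 2 l ≤ k := Nat.le_ceil _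
  have hk2 : (k : ℝ) < n / Real.logb 2 l + 1 := Nat.ceil_lt_add_one (by positivity)
  have hpow : 2 ^ n ≤ l ^ k := by
    have : (2 : ℝ) ^ n ≤ (l : ℝ) ^ k := by
      rw [← Real.logb_le_logb one_lt_two (by positivity) (by positivity), Real.logb_pow,
        Real.logb_pow, Real.logb_self_eq_one one_lt_two, mul_one]
      exact (div_le_iff₀ hlog).1 hk1
    exact_mod_cast this
  have hR := supportRank_le ((h.MMSupport_pow k).MMSupport_mono hpow)
  have hRlog : Real.logb 2 (SupportRank F (MMSupport (2 ^ n) (2 ^ n) (2 ^ n))) ≤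
      k * Real.logb 2 L := by
    rw [← Real.logb_pow]
    rcases Nat.eq_zero_or_pos (SupportRank F (MMSupport (2 ^ n) (2 ^ n) (2 ^ n))) with h0 | h0
    · rw [h0, Nat.cast_zero, Real.logb_zero, Real.logb_pow]
      positivity
    · exact Real.logb_le_logb_of_le one_lt_two (by exact_mod_cast h0) (by exact_mod_cast hR)
  calc _ ≤ (1 / n : ℝ) * ((n / Real.logb 2 l + 1) * Real.logb 2 L) := by
        gcongr
        exact hRlog.trans (by gcongr)
    _ = _ := by field_simp

variable (F) in
theorem omegaS_sequence_nonneg (n : ℕ) :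
    0 ≤ (1 / n : ℝ) * Real.logb 2 (SupportRank F (MMSupport ⌊(2 : ℝ) ^ ((1 : ℝ) * n)⌋₊
      ⌊(2 : ℝ) ^ ((1 : ℝ) * n)⌋₊ ⌊(2 : ℝ) ^ ((1 : ℝ) * n)⌋₊)) := by
  refine mul_nonneg (by positivity) ?_
  rcases Nat.eq_zero_or_pos (SupportRank F (MMSupport ⌊(2 : ℝ) ^ ((1 : ℝ) * n)⌋₊
    ⌊(2 : ℝ) ^ ((1 : ℝ) * n)⌋₊ ⌊(2 : ℝ) ^ ((1 : ℝ) * n)⌋₊)) with h0 | h0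
  · simp [h0]
  · exact Real.logb_nonneg one_lt_two (by exact_mod_cast h0)

variable (F) in
theorem omegaS_nonneg : 0 ≤ omegaS F 1 1 1 := by
  refine Filter.le_limsup_of_frequently_le
    (Filter.Eventually.frequently (Filter.Eventually.of_forall (omegaS_sequence_nonneg F))) ?_
  have h := suppRankLE_supportRank (F := F) (MMSupport 2 2 2)
  set L := SupportRank F (MMSupport 2 2 2)
  refine ⟨Real.logb 2 L / Real.logb 2 (2 : ℕ) + Real.logb 2 L, ?_⟩
  rw [Filter.eventually_map]
  filter_upwards [Filter.eventually_gt_atTop 0] with n hn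
  refine (omegaS_sequence_le F le_rfl h hn).trans ?_
  have hL : 0 ≤ Real.logb 2 (L : ℝ) := by
    rcases Nat.eq_zero_or_pos L with h0 | h0
    · simp [h0]
    · exact Real.logb_nonneg one_lt_two (by exact_mod_cast h0)
  have hn1 : (1 : ℝ) ≤ n := by exact_mod_cast hn
  gcongr
  exact div_le_self hL hn1

/-- Square matrix multiplication of size `l` has support rank at least `l ^ ω_s`. -/
theorem rpow_omegaS_le {l L : ℕ} (hl : 1 ≤ l) (h : SuppRankLE F (MMSupport l l l) L) :
    (l : ℝ) ^ omegaS F 1 1 1 ≤ L := by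
  have hL : 1 ≤ L := one_le_of_suppRankLE
    ⟨((⟨0, by omega⟩, ⟨0, by omega⟩), (⟨0, by omega⟩, ⟨0, by omega⟩), (⟨0, by omega⟩, ⟨0, by omega⟩)),
      mem_MMSupport.2 ⟨rfl, rfl, rfl⟩⟩ h
  have hLr : (1 : ℝ) ≤ L := by exact_mod_cast hL
  rcases hl.eq_or_lt with rfl | hl2
  · simpa using hLr
  have hl1 : (1 : ℝ) < l := by exact_mod_cast hl2
  have hlog : 0 < Real.logb 2 l := Real.logb_pos one_lt_two hl1
  have hlim : Filter.Tendsto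
      (fun n : ℕ => Real.logb 2 L / Real.logb 2 l + Real.logb 2 L / (n : ℝ)) Filter.atTop
      (nhds (Real.logb 2 L / Real.logb 2 l)) := by
    simpa using (tendsto_const_div_atTop_nhds_zero_nat (Real.logb 2 L)).const_add
      (Real.logb 2 L / Real.logb 2 l)
  have hω : omegaS F 1 1 1 ≤ Real.logb 2 L / Real.logb 2 l := by
    rw [← hlim.limsup_eq]
    refine Filter.limsup_le_limsup ?_ ?_ hlim.isBoundedUnder_le
    · filter_upwards [Filter.eventually_gt_atTop 0] with n hn
      exact omegaS_sequence_le F hl2 h hn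
    · exact Filter.IsBoundedUnder.isCoboundedUnder_le
        ⟨0, Filter.eventually_map.2 (Filter.Eventually.of_forall (omegaS_sequence_nonneg F))⟩
  rw [le_div_iff₀ hlog] at hω
  rw [← Real.logb_le_logb one_lt_two (by positivity) (by positivity),
    Real.logb_rpow_eq_mul_logb_of_pos (by positivity)]
  exact hω

end MatrixMultiplication

section Covering

/-- If every task is met by at least half of the candidates, then `M` candidates suffice to meet
fewer than `2 ^ M` tasks. -/
theorem exists_cover {W H : Type*} [Fintype H] [Nonempty H] (hit : W → H → Prop)
    (hhalf : ∀ w, Fintype.card H ≤ 2 * {h | hit w h}.ncard) (M : ℕ) (S : Finset W)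
    (hS : S.card < 2 ^ M) : ∃ T : Fin M → H, ∀ w ∈ S, ∃ m, hit w (T m) := by
  classical
  induction M generalizing S with
  | zero =>
    obtain rfl : S = ∅ := by simpa using hS
    exact ⟨Fin.elim0, by simp⟩
  | succ M ih =>
    have hcard : ∀ w, {h | hit w h}.ncard = ∑ h : H, if hit w h then 1 else 0 := by
      intro w
      rw [Set.ncard_eq_toFinset_card', Finset.sum_boole]
      simp
    obtain ⟨h, -, hh⟩ : ∃ h ∈ (Finset.univ : Finset H), S.card ≤
        2 * ∑ w ∈ S, (if hit w h then 1 else 0) := by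
      apply Finset.exists_le_of_sum_le Finset.univ_nonempty
      rw [← Finset.mul_sum, Finset.sum_comm, Finset.mul_sum, Finset.sum_const, smul_eq_mul,
        Finset.card_univ, mul_comm]
      rw [← smul_eq_mul, ← Finset.sum_const]
      exact Finset.sum_le_sum fun w _ => by rw [← hcard]; exact hhalf w
    have hsum : ∑ w ∈ S, (if hit w h then 1 else 0) = (S.filter fun w => hit w h).card := by
      simp
    have hsplit := Finset.card_filter_add_card_filter_not (s := S) (fun w => hit w h)
    obtain ⟨T, hT⟩ := ih (S.filter fun w => ¬ hit w h) (by rw [pow_succ] at hS; omega)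
    refine ⟨Fin.cons h T, fun w hw => ?_⟩
    by_cases hc : hit w h
    · exact ⟨0, hc⟩
    · obtain ⟨m, hm⟩ := hT w (by simp [hw, hc])
      exact ⟨m.succ, hm⟩

theorem two_mul_pow_le_succ_pow {b n : ℕ} (h : b + 1 ≤ n) : 2 * b ^ n ≤ (b + 1) ^ n := by
  have key : ∀ n : ℕ, (b + n) * b ^ n ≤ b * (b + 1) ^ n := by
    intro n
    induction n with
    | zero => simp
    | succ n ih =>
      calc (b + (n + 1)) * b ^ (n + 1) = (b * (b + (n + 1))) * b ^ n := by ring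
        _ ≤ ((b + n) * (b + 1)) * b ^ n := Nat.mul_le_mul_right _ (by nlinarith)
        _ = ((b + n) * b ^ n) * (b + 1) := by ring
        _ ≤ (b * (b + 1) ^ n) * (b + 1) := by gcongr
        _ = b * (b + 1) ^ (n + 1) := by ring
  rcases Nat.eq_zero_or_pos b with rfl | hb
  · simp [show n ≠ 0 by omega]
  · refine Nat.le_of_mul_le_mul_left ?_ hb
    calc b * (2 * b ^ n) = (b + b) * b ^ n := by ring
      _ ≤ (b + n) * b ^ n := by gcongr; omega
      _ ≤ _ := key n

/-- At least half of all maps `J → Fin B` attain a given value on a set of size at least `B`. -/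
theorem card_le_two_mul_hitting {J : Type*} [Fintype J] {B : ℕ} (S : Finset J)
    (hS : B ≤ S.card) (b : Fin B) :
    Nat.card (J → Fin B) ≤ 2 * {ψ : J → Fin B | ∃ j ∈ S, ψ j = b}.ncard := by
  classical
  have hsum := Set.ncard_add_ncard_compl {ψ : J → Fin B | ∃ j ∈ S, ψ j = b}
  have hcompl : ({ψ : J → Fin B | ∃ j ∈ S, ψ j = b}ᶜ).ncard =
      (B - 1) ^ S.card * B ^ (Fintype.card J - S.card) := by
    have : {ψ : J → Fin B | ∃ j ∈ S, ψ j = b}ᶜ = (Fintype.piFinset fun j =>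
        if j ∈ S then Finset.univ.erase b else Finset.univ : Finset (J → Fin B)) := by
      ext ψ
      simp only [Set.mem_compl_iff, Set.mem_ofPred_eq, not_exists, not_and, Finset.mem_coe,
        Fintype.mem_piFinset]
      refine forall_congr' fun j => ?_
      by_cases hj : j ∈ S <;> simp [hj]
    rw [this, Set.ncard_coe_finset, Fintype.card_piFinset]
    have hc : ∀ j, (if j ∈ S then Finset.univ.erase b else Finset.univ : Finset (Fin B)).card =
        if j ∈ S then B - 1 else B := by
      intro j
      by_cases hj : j ∈ S <;> simp [hj]
    simp only [hc]
    rw [Finset.prod_ite]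
    simp [Finset.filter_not, Finset.card_sdiff]
  have htot : Nat.card (J → Fin B) = B ^ S.card * B ^ (Fintype.card J - S.card) := by
    rw [← pow_add, Nat.add_sub_cancel' (Finset.card_le_univ S)]
    simp
  have hB : 0 < B := b.pos
  have hpow : 2 * (B - 1) ^ S.card ≤ B ^ S.card := by
    have := two_mul_pow_le_succ_pow (b := B - 1) (n := S.card) (by omega)
    rwa [Nat.sub_add_cancel hB] at this
  have : 2 * ((B - 1) ^ S.card * B ^ (Fintype.card J - S.card)) ≤ Nat.card (J → Fin B) := by
    rw [htot, ← mul_assoc]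
    gcongr
  omega

/-- A bipartite graph contains, up to a logarithmic loss, an almost regular part. -/
theorem exists_degree_le {α β : Type*} [Fintype β] (E : Finset (α × β)) (hE : E.Nonempty) :
    ∃ (S : Finset α) (B : ℕ), S.Nonempty ∧ 1 ≤ B ∧
      (∀ a ∈ S, ∃ T : Finset β, B ≤ T.card ∧ ∀ b ∈ T, (a, b) ∈ E) ∧
      E.card ≤ (Nat.log 2 (Fintype.card β) + 1) * (2 * (S.card * B)) := by
  classical
  let N : α → Finset β := fun a => Finset.univ.filter fun b => (a, b) ∈ E
  let D := Nat.log 2 (Fintype.card β) + 1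
  have hmaps : ∀ q ∈ E, Nat.log 2 (N q.1).card ∈ Finset.range D := fun q _ =>
    Finset.mem_range.2 (Nat.lt_succ_of_le (Nat.log_mono_right (Finset.card_le_univ _)))
  obtain ⟨l, -, hl⟩ : ∃ l ∈ Finset.range D,
      E.card ≤ D * (E.filter fun q => Nat.log 2 (N q.1).card = l).card := by
    apply Finset.exists_le_of_sum_le ⟨0, by simp [D]⟩
    rw [← Finset.mul_sum, ← Finset.card_eq_sum_card_fiberwise hmaps]
    simp
  set E' := E.filter fun q => Nat.log 2 (N q.1).card = l with hE'
  have hE'ne : E'.Nonempty := by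
    rw [← Finset.card_pos]
    have := hE.card_pos
    by_contra h0
    simp [show E'.card = 0 by omega] at hl
    simp [hl] at hE
  refine ⟨E'.image Prod.fst, 2 ^ l, hE'ne.image _, Nat.one_le_two_pow, ?_, ?_⟩
  · intro a ha
    obtain ⟨q, hq, rfl⟩ := Finset.mem_image.1 ha
    obtain ⟨hqE, hql⟩ := Finset.mem_filter.1 hq
    refine ⟨N q.1, ?_, fun b hb => (Finset.mem_filter.1 hb).2⟩
    rw [← hql]
    exact Nat.pow_log_le_self 2 (Finset.card_pos.2 ⟨q.2, by simp [N, hqE]⟩).ne'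
  · refine hl.trans (Nat.mul_le_mul_left _ ?_)
    have h1 : E'.card = ∑ a ∈ E'.image Prod.fst, (E'.filter fun q => q.1 = a).card :=
      Finset.card_eq_sum_card_fiberwise fun q hq => Finset.mem_image_of_mem _ hq
    rw [h1, mul_left_comm, ← smul_eq_mul, ← Finset.sum_const]
    refine Finset.sum_le_sum fun a ha => ?_
    obtain ⟨q, hq, rfl⟩ := Finset.mem_image.1 ha
    obtain ⟨hqE, hql⟩ := Finset.mem_filter.1 hq
    have h2 : (E'.filter fun q' => q'.1 = q.1).card ≤ (N q.1).card := by
      refine Finset.card_le_card_of_injOn Prod.snd ?_ ?_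
      · intro q' hq'
        obtain ⟨hq1, hq2⟩ := Finset.mem_filter.1 hq'
        have := (Finset.mem_filter.1 hq1).1
        simp only [N, Finset.coe_filter, Finset.mem_univ, true_and, Set.mem_ofPred_eq, ← hq2]
        exact this
      · intro q1 h1 q2 h2 h12
        exact Prod.ext ((Finset.mem_filter.1 h1).2.trans (Finset.mem_filter.1 h2).2.symm) h12
    have h3 := Nat.lt_pow_succ_log_self one_lt_two (N q.1).card
    rw [hql, pow_succ] at h3
    omega

end Covering

section PatternToMatrix

variable {F : Type*} [Field F] [Infinite F] {I J K : Type*} [Fintype I] [Fintype J] [Fintype K]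

/-- A tree-like part of a pattern folds onto a full matrix multiplication. -/
theorem SuppRankLE.MMSupport_of_tree {Λ : Set (I × J × K)} {L : ℕ}
    (h : SuppRankLE F (pmmSupport Λ) L) (S : Finset I) (hS : S.Nonempty) {B C M : ℕ}
    (hB : 1 ≤ B) (hC : 1 ≤ C) (E : Finset (I × J))
    (hSE : ∀ i ∈ S, ∃ T : Finset J, B ≤ T.card ∧ ∀ j ∈ T, (i, j) ∈ E)
    (hEΛ : ∀ q ∈ E, ∃ T : Finset K, C ≤ T.card ∧ ∀ k ∈ T, (q.1, q.2, k) ∈ Λ)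
    (hM : S.card * B < 2 ^ M) (hM' : E.card * C < 2 ^ M) :
    SuppRankLE F (MMSupport S.card B C) (M * M * L) := by
  classical
  have : Nonempty (Fin B) := ⟨⟨0, hB⟩⟩
  have : Nonempty (Fin C) := ⟨⟨0, hC⟩⟩
  choose T hT hTE using hSE
  choose U hU hUΛ using hEΛ
  obtain ⟨ψ, hψ⟩ := exists_cover (W := S × Fin B) (H := J → Fin B)
    (fun w ψ => ∃ j ∈ T w.1 w.1.2, ψ j = w.2)
    (fun w => by
      rw [← Nat.card_eq_fintype_card]
      exact card_le_two_mul_hitting _ (hT _ _) _) M Finset.univ (by simpa using hM)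
  obtain ⟨χ, hχ⟩ := exists_cover (W := E × Fin C) (H := K → Fin C)
    (fun w χ => ∃ k ∈ U w.1 w.1.2, χ k = w.2)
    (fun w => by
      rw [← Nat.card_eq_fintype_card]
      exact card_le_two_mul_hitting _ (hU _ _) _) M Finset.univ (by simpa using hM')
  let i₀ : S := ⟨hS.choose, hS.choose_spec⟩
  let φ : I → Fin S.card := fun i => S.equivFin (if hi : i ∈ S then ⟨i, hi⟩ else i₀)
  have hfold : ∀ m : Fin M × Fin M, SuppRankLE F
      (Prod.map (Prod.map φ (ψ m.1)) (Prod.map (Prod.map (ψ m.1) (χ m.2))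
        (Prod.map (χ m.2) φ)) '' pmmSupport Λ) L := fun m => h.image _ _ _
  have hU' := SuppRankLE.iUnion hfold
  rw [Fintype.card_prod, Fintype.card_fin] at hU'
  convert hU' using 1
  ext ⟨⟨a, b⟩, ⟨b', c⟩, ⟨c', a'⟩⟩
  rw [mem_MMSupport]
  simp only [Set.mem_iUnion, Set.mem_image]
  constructor
  · rintro ⟨rfl, rfl, rfl⟩
    let i := S.equivFin.symm a'
    obtain ⟨m, j, hj, hjb⟩ := hψ (i, b) (Finset.mem_univ _)
    have hij := hTE _ _ j hj
    obtain ⟨m', k, hk, hkc⟩ := hχ (⟨(i, j), hij⟩, c) (Finset.mem_univ _)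
    refine ⟨(m, m'), ((i, j), (j, k), (k, i)), mem_pmmSupport.2 ⟨rfl, rfl, rfl, hUΛ _ _ _ hk⟩, ?_⟩
    have hφ : φ i = a' := by simp [φ, i]
    simp only [Prod.map_apply, hφ, hjb, hkc]
  · rintro ⟨m, ⟨⟨i, j⟩, ⟨j', k⟩, ⟨k', i'⟩⟩, hq, heq⟩
    obtain ⟨rfl, rfl, rfl, -⟩ := mem_pmmSupport.1 hq
    simp only [Prod.map_apply, Prod.mk.injEq] at heq
    obtain ⟨⟨rfl, rfl⟩, ⟨rfl, rfl⟩, rfl, rfl⟩ := heq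
    simp

/-- A pattern folds onto a matrix multiplication of almost the same volume. -/
theorem SuppRankLE.exists_MMSupport {Λ : Set (I × J × K)} (hΛ : Λ.Nonempty) {L M : ℕ}
    (h : SuppRankLE F (pmmSupport Λ) L)
    (hM : Fintype.card I * Fintype.card J * Fintype.card K < 2 ^ M) :
    ∃ A B C : ℕ, 1 ≤ A * B * C ∧ Λ.ncard ≤ 4 * M ^ 2 * (A * B * C) ∧
      SuppRankLE F (MMSupport A B C) (M * M * L) := by
  classical
  obtain ⟨⟨i₀, j₀, k₀⟩, h₀⟩ := hΛ
  have hI : 0 < Fintype.card I := Fintype.card_pos_iff.2 ⟨i₀⟩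
  have hJ : 0 < Fintype.card J := Fintype.card_pos_iff.2 ⟨j₀⟩
  have hK : 0 < Fintype.card K := Fintype.card_pos_iff.2 ⟨k₀⟩
  let G : Finset ((I × J) × K) := Finset.univ.filter fun q => (q.1.1, q.1.2, q.2) ∈ Λ
  have hG : Λ.ncard = G.card := by
    rw [← Set.ncard_coe_finset]
    refine Set.ncard_congr (fun q _ => ((q.1, q.2.1), q.2.2)) ?_ ?_ ?_
    · intro q hq
      simpa [G] using hq
    · rintro ⟨i, j, k⟩ ⟨i', j', k'⟩ - -
      simp +contextual
    · rintro ⟨⟨i, j⟩, k⟩ hq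
      exact ⟨(i, j, k), by simpa [G] using hq, rfl⟩
  obtain ⟨E, C, hE, hC, hEG, hcard⟩ := exists_degree_le G ⟨((i₀, j₀), k₀), by simp [G, h₀]⟩
  obtain ⟨S, B, hS, hB, hSE, hcard'⟩ := exists_degree_le E hE
  have hlog : ∀ n : ℕ, n < 2 ^ M → Nat.log 2 n + 1 ≤ M := by
    intro n hn
    rcases Nat.eq_zero_or_pos n with rfl | h0
    · have : M ≠ 0 := by
        rintro rfl
        have := Nat.mul_pos (Nat.mul_pos hI hJ) hK
        omega
      simp
      omega
    · exact Nat.log_lt_of_lt_pow h0.ne' hn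
  have hKM : Fintype.card K < 2 ^ M :=
    (Nat.le_mul_of_pos_left _ (Nat.mul_pos hI hJ)).trans_lt hM
  have hJM : Fintype.card J < 2 ^ M :=
    ((Nat.le_mul_of_pos_left _ hI).trans (Nat.le_mul_of_pos_right _ hK)).trans_lt hM
  obtain ⟨i, hi⟩ := hS
  obtain ⟨q, hq⟩ := hE
  have hBJ : B ≤ Fintype.card J := by
    obtain ⟨T, hT, -⟩ := hSE i hi
    exact hT.trans (Finset.card_le_univ T)
  have hCK : C ≤ Fintype.card K := by
    obtain ⟨T, hT, -⟩ := hEG q hq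
    exact hT.trans (Finset.card_le_univ T)
  refine ⟨S.card, B, C, ?_, ?_, h.MMSupport_of_tree S ⟨i, hi⟩ hB hC E hSE
    (fun q hq => ?_) ?_ ?_⟩
  · exact Nat.mul_pos (Nat.mul_pos (Finset.card_pos.2 ⟨i, hi⟩) hB) hC
  · rw [hG]
    calc G.card ≤ (Nat.log 2 (Fintype.card K) + 1) * (2 * (E.card * C)) := hcard
      _ ≤ M * (2 * ((M * (2 * (S.card * B))) * C)) := by
        have h1 := hlog _ hKM
        have h2 := hcard'.trans (Nat.mul_le_mul_right _ (hlog _ hJM))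
        gcongr
      _ = _ := by ring
  · obtain ⟨T, hT, hTG⟩ := hEG q hq
    exact ⟨T, hT, fun k hk => by simpa [G] using hTG k hk⟩
  · calc S.card * B ≤ Fintype.card I * Fintype.card J :=
        Nat.mul_le_mul (Finset.card_le_univ S) hBJ
      _ ≤ Fintype.card I * Fintype.card J * Fintype.card K := Nat.le_mul_of_pos_right _ hK
      _ < _ := hM
  · calc E.card * C ≤ Fintype.card I * Fintype.card J * Fintype.card K :=
        Nat.mul_le_mul ((Finset.card_le_univ E).trans_eq (Fintype.card_prod _ _)) hCK
      _ < _ := hM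

theorem le_of_pow_le_poly_mul_pow {x y c : ℝ} (hy : 0 ≤ y) (d : ℕ)
    (h : ∀ n : ℕ, 0 < n → x ^ n ≤ c * (n : ℝ) ^ d * y ^ n) : x ≤ y := by
  by_contra! hlt
  rcases hy.eq_or_lt with rfl | hy
  · have := h 1 one_pos
    simp at this
    linarith
  have hxy : 1 < x / y := (one_lt_div hy).2 hlt
  have hlim := (tendsto_pow_const_div_const_pow_of_one_lt d hxy).const_mul c
  rw [mul_zero] at hlim
  obtain ⟨n, hn, hn0⟩ := ((hlim.eventually (gt_mem_nhds one_pos)).and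
    (Filter.eventually_gt_atTop 0)).exists
  have h1 := h n hn0
  have hyn : 0 < y ^ n := pow_pos hy n
  have hxn : 0 < (x / y) ^ n := pow_pos (by linarith) n
  rw [← mul_div_assoc, div_lt_one hxn, div_pow, lt_div_iff₀ hyn] at hn
  linarith

/-- If the powers of `Φ(Λ)` have support rank `O(c ^ N)`, then `|Λ| ^ (ω_s / 3) ≤ c`. -/
theorem ncard_rpow_le_of_pow {Λ : Set (I × J × K)} (hΛ : Λ.Nonempty) {q c : ℕ}
    (h : ∀ N, SuppRankLE F (pmmSupport (piPattern fun _ : Fin N => Λ)) (q * c ^ N)) :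
    (Λ.ncard : ℝ) ^ (omegaS F 1 1 1 / 3) ≤ c := by
  set ω := omegaS F 1 1 1
  have hω : 0 ≤ ω := omegaS_nonneg F
  set κ := Fintype.card I * Fintype.card J * Fintype.card K + 1 with hκ
  let d := ⌈ω / 3⌉₊
  have hd : ω / 3 ≤ d := Nat.le_ceil _
  refine le_of_pow_le_poly_mul_pow (by positivity)
    (c := (4 * (κ : ℝ) ^ 2) ^ d * ((κ : ℝ) ^ 2 * q)) (2 * d + 2) fun N hN => ?_
  have hM : Fintype.card (Fin N → I) * Fintype.card (Fin N → J) * Fintype.card (Fin N → K) <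
      2 ^ (κ * N) := by
    simp only [Fintype.card_fun, Fintype.card_fin]
    rw [← mul_pow, ← mul_pow, pow_mul]
    exact Nat.pow_lt_pow_left ((Nat.lt_succ_self _).trans Nat.lt_two_pow_self) hN.ne'
  obtain ⟨⟨i, j, k⟩, hq⟩ := hΛ
  have hne : (piPattern fun _ : Fin N => Λ).Nonempty :=
    ⟨(fun _ => i, fun _ => j, fun _ => k), fun _ => hq⟩
  obtain ⟨A, B, C, hpos, hcard, hABC⟩ := (h N).exists_MMSupport hne hM
  rw [ncard_piPattern, Finset.prod_const, Finset.card_univ, Fintype.card_fin] at hcard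
  set V := A * B * C
  have hV := rpow_omegaS_le hpos hABC.MMSupport_symm
  have hκN : (1 : ℝ) ≤ 4 * ((κ * N : ℕ) : ℝ) ^ 2 := by
    have : (1 : ℝ) ≤ ((κ * N : ℕ) : ℝ) := by
      exact_mod_cast Nat.mul_pos (Nat.succ_pos _) hN
    nlinarith
  have hcard' : (Λ.ncard : ℝ) ^ N ≤ 4 * ((κ * N : ℕ) : ℝ) ^ 2 * V := by exact_mod_cast hcard
  have hV3 : (V : ℝ) ^ (ω / 3) ≤ ((κ * N * (κ * N) * (q * c ^ N) : ℕ) : ℝ) := by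
    have h3 : ((V : ℝ) ^ (ω / 3)) ^ 3 = (V : ℝ) ^ ω := by
      rw [← Real.rpow_natCast, ← Real.rpow_mul (by positivity)]
      norm_num
    refine le_of_pow_le_pow_left₀ three_ne_zero (by positivity) ?_
    rw [h3]
    exact_mod_cast hV
  calc ((Λ.ncard : ℝ) ^ (ω / 3)) ^ N = ((Λ.ncard : ℝ) ^ N) ^ (ω / 3) := by
        rw [← Real.rpow_natCast, ← Real.rpow_natCast, ← Real.rpow_mul (by positivity),
          ← Real.rpow_mul (by positivity), mul_comm]
    _ ≤ (4 * ((κ * N : ℕ) : ℝ) ^ 2 * V) ^ (ω / 3) :=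
        Real.rpow_le_rpow (by positivity) hcard' (by positivity)
    _ = (4 * ((κ * N : ℕ) : ℝ) ^ 2) ^ (ω / 3) * (V : ℝ) ^ (ω / 3) :=
        Real.mul_rpow (by positivity) (by positivity)
    _ ≤ (4 * ((κ * N : ℕ) : ℝ) ^ 2) ^ (d : ℝ) *
        ((κ * N * (κ * N) * (q * c ^ N) : ℕ) : ℝ) := by
        gcongr
    _ = _ := by
        rw [Real.rpow_natCast]
        push_cast
        ring

end PatternToMatrix

section DirectSum

variable {F : Type*} [Field F]

open Classical in
/-- The direct sum of copies of the tensor `s` indexed by `V`. -/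
noncomputable def copies (V : Type*) {X Y Z : Type*} (s : X → Y → Z → F) :
    V × X → V × Y → V × Z → F :=
  fun x y z => if x.1 = y.1 ∧ y.1 = z.1 then s x.2 y.2 z.2 else 0

variable {V X Y Z X' Y' Z' : Type*} [Fintype V]

/-- Schönhage's recursion: the products computing `copies V s` are grouped into `c` batches of
at most `|V|` products each. -/
theorem RankLE.copies_mul {s : X → Y → Z → F} {u : X' → Y' → Z' → F} {r L c : ℕ}
    (hs : RankLE (copies V s) r) (hu : RankLE (copies V u) L) (hr : r ≤ c * Fintype.card V) :
    RankLE (copies V fun (x : X × X') (y : Y × Y') (z : Z × Z') =>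
      s x.1 y.1 z.1 * u x.2 y.2 z.2) (c * L) := by
  classical
  obtain ⟨a, b, d, hs⟩ := hs
  obtain ⟨a', b', d', hu⟩ := hu
  obtain ⟨g⟩ : Nonempty (Fin r ↪ Fin c × V) :=
    Function.Embedding.nonempty_of_card_le (by simpa using hr)
  refine RankLE.of_fintype (ι := Fin c × Fin L) (by simp)
    (fun m x => ∑ n, if (g n).1 = m.1 then a n (x.1, x.2.1) * a' m.2 ((g n).2, x.2.2) else 0)
    (fun m y => ∑ n, if (g n).1 = m.1 then b n (y.1, y.2.1) * b' m.2 ((g n).2, y.2.2) else 0)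
    (fun m z => ∑ n, if (g n).1 = m.1 then d n (z.1, z.2.1) * d' m.2 ((g n).2, z.2.2) else 0)
    ?_
  rintro ⟨v, x, x'⟩ ⟨v', y, y'⟩ ⟨v'', z, z'⟩
  have hleft : copies V (fun (x : X × X') (y : Y × Y') (z : Z × Z') =>
      s x.1 y.1 z.1 * u x.2 y.2 z.2) (v, x, x') (v', y, y') (v'', z, z') =
      ∑ n, a n (v, x) * b n (v', y) * d n (v'', z) * u x' y' z' := by
    rw [← Finset.sum_mul, ← hs]
    simp only [copies, ite_mul, zero_mul]
  have hdiag : ∀ n n' n'' : Fin r, (∑ m : Fin c × Fin L,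
      (if (g n).1 = m.1 then a' m.2 ((g n).2, x') else 0) *
      (if (g n').1 = m.1 then b' m.2 ((g n').2, y') else 0) *
      (if (g n'').1 = m.1 then d' m.2 ((g n'').2, z') else 0)) =
      if n = n' ∧ n' = n'' then u x' y' z' else 0 := by
    intro n n' n''
    have h1 : (∑ m : Fin c × Fin L,
        (if (g n).1 = m.1 then a' m.2 ((g n).2, x') else 0) *
        (if (g n').1 = m.1 then b' m.2 ((g n').2, y') else 0) *
        (if (g n'').1 = m.1 then d' m.2 ((g n'').2, z') else 0)) =
        ∑ m : Fin c, if (g n).1 = m ∧ (g n').1 = m ∧ (g n'').1 = m then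
          copies V u ((g n).2, x') ((g n').2, y') ((g n'').2, z') else 0 := by
      rw [Fintype.sum_prod_type]
      refine Finset.sum_congr rfl fun m _ => ?_
      rw [hu]
      by_cases h1 : (g n).1 = m <;> by_cases h2 : (g n').1 = m <;>
        by_cases h3 : (g n'').1 = m <;> simp [h1, h2, h3]
    rw [h1]
    by_cases hc : n = n' ∧ n' = n''
    · obtain ⟨rfl, rfl⟩ := hc
      simp [copies]
    · rw [if_neg hc]
      refine Finset.sum_eq_zero fun m _ => ?_
      split_ifs with hm
      · obtain ⟨h1, h2, h3⟩ := hm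
        refine if_neg fun h => hc ?_
        exact ⟨g.injective (Prod.ext (h1.trans h2.symm) h.1),
          g.injective (Prod.ext (h2.trans h3.symm) h.2)⟩
      · rfl
  rw [hleft]
  have hexpand : ∀ m : Fin c × Fin L,
      (∑ n, if (g n).1 = m.1 then a n (v, x) * a' m.2 ((g n).2, x') else 0) *
      (∑ n, if (g n).1 = m.1 then b n (v', y) * b' m.2 ((g n).2, y') else 0) *
      (∑ n, if (g n).1 = m.1 then d n (v'', z) * d' m.2 ((g n).2, z') else 0) =
      ∑ n, ∑ n', ∑ n'', a n (v, x) * b n' (v', y) * d n'' (v'', z) *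
        ((if (g n).1 = m.1 then a' m.2 ((g n).2, x') else 0) *
        (if (g n').1 = m.1 then b' m.2 ((g n').2, y') else 0) *
        (if (g n'').1 = m.1 then d' m.2 ((g n'').2, z') else 0)) := by
    intro m
    rw [mul_assoc, Finset.sum_mul_sum, Finset.sum_mul_sum]
    refine Finset.sum_congr rfl fun n _ => Finset.sum_congr rfl fun n' _ => ?_
    rw [Finset.mul_sum]
    refine Finset.sum_congr rfl fun n'' _ => ?_
    split_ifs <;> ring
  simp only [hexpand]
  rw [Finset.sum_comm]
  refine Finset.sum_congr rfl fun n _ => ?_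
  rw [Finset.sum_comm, Finset.sum_eq_single n]
  · rw [Finset.sum_comm, Finset.sum_eq_single n]
    · rw [← Finset.mul_sum, hdiag]
      simp
    · intro n'' _ hne
      rw [← Finset.mul_sum, hdiag, if_neg fun h => hne h.2.symm, mul_zero]
    · simp
  · intro n' _ hne
    rw [Finset.sum_comm]
    refine Finset.sum_eq_zero fun n'' _ => ?_
    rw [← Finset.mul_sum, hdiag, if_neg fun h => hne h.1.symm, mul_zero]
  · simp

theorem RankLE.copies_pow {s : X → Y → Z → F} {r c : ℕ}
    (hs : RankLE (copies V s) r) (hr : r ≤ c * Fintype.card V) (n : ℕ) :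
    RankLE (copies V fun (x : Fin n → X) (y : Fin n → Y) (z : Fin n → Z) =>
      ∏ i, s (x i) (y i) (z i)) (c ^ n * Fintype.card V) := by
  classical
  induction n with
  | zero =>
    refine RankLE.of_fintype (ι := V) (by simp) (fun v x => if x.1 = v then 1 else 0)
      (fun v y => if y.1 = v then 1 else 0) (fun v z => if z.1 = v then 1 else 0) ?_
    rintro ⟨v, x⟩ ⟨v', y⟩ ⟨v'', z⟩
    simp only [copies, Finset.univ_eq_empty, Finset.prod_empty]
    rw [Finset.sum_eq_single v]
    · by_cases h1 : v' = v <;> by_cases h2 : v'' = v <;> simp [h1, h2, Ne.symm]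
    · intro w _ hw
      simp [Ne.symm hw]
    · simp
  | succ n ih =>
    have h := (hs.copies_mul ih hr).comap
      (fun x : V × (Fin (n + 1) → X) => (x.1, x.2 0, Fin.tail x.2))
      (fun y : V × (Fin (n + 1) → Y) => (y.1, y.2 0, Fin.tail y.2))
      (fun z : V × (Fin (n + 1) → Z) => (z.1, z.2 0, Fin.tail z.2))
    rw [pow_succ', mul_assoc]
    convert h using 4
    simp only [copies, Fin.prod_univ_succ, Fin.tail]

/-- The direct sum of `|V|` copies of a nonzero tensor has rank at least `|V|`. -/
theorem RankLE.card_le_of_copies {s : X → Y → Z → F} {r : ℕ} (hs : RankLE (copies V s) r)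
    {x : X} {y : Y} {z : Z} (h0 : s x y z ≠ 0) : Fintype.card V ≤ r := by
  classical
  obtain ⟨a, b, c, hs⟩ := hs
  let A : Matrix V (Fin r) F := fun v m => a m (v, x)
  let B : Matrix (Fin r) V F := fun m v => b m (v, y) * ∑ w, c m (w, z)
  have hAB : A * B = Matrix.diagonal fun _ => s x y z := by
    ext v v'
    have : (A * B) v v' = ∑ w, copies V s (v, x) (v', y) (w, z) := by
      simp only [hs]
      rw [Finset.sum_comm, Matrix.mul_apply]
      refine Finset.sum_congr rfl fun m _ => ?_
      simp only [A, B]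
      rw [← mul_assoc, Finset.mul_sum]
    rw [this, Matrix.diagonal_apply]
    by_cases hv : v = v'
    · simp [copies, hv]
    · simp [copies, hv]
  have h1 : (A * B).rank = Fintype.card V := by
    rw [hAB, Matrix.rank_diagonal]
    simp [h0]
  rw [← h1]
  exact ((Matrix.rank_mul_le_left A B).trans (Matrix.rank_le_card_width A)).trans_eq
    (Fintype.card_fin r)

variable [Infinite F] {I J K : Type*} [Fintype I] [Fintype J] [Fintype K]

theorem card_mul_rpow_le_of_copies [Nonempty V] {s : I × J → J × K → K × I → F}
    {Λ : Set (I × J × K)} (hΛ : Λ.Nonempty)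
    (hs : ∀ x y z, s x y z ≠ 0 ↔ (x, y, z) ∈ pmmSupport Λ) {r : ℕ}
    (hr : RankLE (copies V s) r) :
    (Fintype.card V : ℝ) * (Λ.ncard : ℝ) ^ (omegaS F 1 1 1 / 3) ≤ 2 * r := by
  set q := Fintype.card V
  have hq : 0 < q := Fintype.card_pos
  have hqr : q ≤ r := by
    obtain ⟨⟨i, j, k⟩, h⟩ := hΛ
    exact hr.card_le_of_copies ((hs (i, j) (j, k) (k, i)).2 ⟨rfl, rfl, rfl, h⟩)
  have hc : r ≤ (r / q + 1) * q := by
    have := Nat.div_add_mod r q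
    have := Nat.mod_lt r hq
    nlinarith
  obtain ⟨v⟩ := ‹Nonempty V›
  have key := ncard_rpow_le_of_pow (F := F) (q := q) (c := r / q + 1) hΛ fun N => by
    refine ⟨_, by
      rw [mul_comm]
      exact (hr.copies_pow hc N).comap
        (fun x : (Fin N → I) × (Fin N → J) => (v, fun n => (x.1 n, x.2 n)))
        (fun y : (Fin N → J) × (Fin N → K) => (v, fun n => (y.1 n, y.2 n)))
        (fun z : (Fin N → K) × (Fin N → I) => (v, fun n => (z.1 n, z.2 n))), ?_⟩
    intro x y z
    rw [← unzip_mem_pow_pmmSupport]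
    simp only [copies, and_self, if_true, ne_eq, Finset.prod_eq_zero_iff, Finset.mem_univ,
      true_and, not_exists, PowSupport, Set.mem_ofPred_eq]
    exact forall_congr' fun n => hs _ _ _
  have h2 : q * (r / q + 1) ≤ 2 * r := by
    have := Nat.mul_div_le r q
    rw [mul_add]
    omega
  calc (q : ℝ) * (Λ.ncard : ℝ) ^ (omegaS F 1 1 1 / 3) ≤ q * ((r / q + 1 : ℕ) : ℝ) := by gcongr
    _ ≤ 2 * r := by exact_mod_cast h2

theorem exists_perm_of_card_fiber_eq {α P : Type*} [Fintype α] [DecidableEq P] {v w : α → P}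
    (h : ∀ a, Fintype.card {s // v s = a} = Fintype.card {s // w s = a}) :
    ∃ σ : Equiv.Perm α, ∀ s, w (σ s) = v s := by
  let e : ∀ a, {s // v s = a} ≃ {s // w s = a} := fun a => Fintype.equivOfCardEq (h a)
  exact ⟨(Equiv.sigmaFiberEquiv v).symm.trans
    ((Equiv.sigmaCongrRight e).trans (Equiv.sigmaFiberEquiv w)), fun s => (e (v s) ⟨s, rfl⟩).2⟩

/-- The support of the direct sum of the partial matrix multiplications `Λ w`, with all patterns
over the same index sets. -/
def sumSupport {P : Type*} (Λ : P → Set (I × J × K)) :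
    Set ((P × I × J) × (P × J × K) × (P × K × I)) :=
  {q | q.1.1 = q.2.1.1 ∧ q.2.1.1 = q.2.2.1 ∧
    (q.1.2, q.2.1.2, q.2.2.2) ∈ pmmSupport (Λ q.1.1)}

theorem sum_rpow_le_of_sumSupport {P : Type*} [Fintype P] {Λ : P → Set (I × J × K)}
    (hΛ : ∀ w, (Λ w).Nonempty) {r : ℕ} (h : SuppRankLE F (sumSupport Λ) r) :
    ∑ w, ((Λ w).ncard : ℝ) ^ (omegaS F 1 1 1 / 3) ≤ r := by
  classical
  set ω := omegaS F 1 1 1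
  obtain ⟨t, ht, hsupp⟩ := h
  let p := Fintype.card P
  refine le_of_pow_le_poly_mul_pow (by positivity) (c := 2 ^ (p + 1)) p fun N hN => ?_
  let type : (Fin N → P) → (P → Fin (N + 1)) := fun v w =>
    ⟨Fintype.card {s // v s = w}, Nat.lt_succ_of_le
      ((Fintype.card_subtype_le _).trans_eq (Fintype.card_fin N))⟩
  let f : (Fin N → P) → ℝ := fun v => ∏ s, ((Λ (v s)).ncard : ℝ) ^ (ω / 3)
  have hclass : ∀ τ, ∑ v : {v // type v = τ}, f v ≤ 2 * (r : ℝ) ^ N := by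
    intro τ
    rcases isEmpty_or_nonempty {v // type v = τ} with hemp | hne
    · simp only [Finset.univ_eq_empty, Finset.sum_empty]
      positivity
    let v₀ := hne.some
    have hperm : ∀ v : {v // type v = τ}, ∃ σ : Equiv.Perm (Fin N), ∀ s, v₀.1 (σ s) = v.1 s :=
      fun v => exists_perm_of_card_fiber_eq fun a => by
        have := congrFun (v.2.trans v₀.2.symm) a
        exact congrArg Fin.val this
    choose σ hσ using hperm
    have hf : ∀ v : {v // type v = τ}, f v = f v₀ := by
      intro v
      simp only [f, ← hσ v]
      exact Equiv.prod_comp (σ v) fun s => ((Λ (v₀.1 s)).ncard : ℝ) ^ (ω / 3)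
    have hcard : f v₀ = ((piPattern fun s => Λ (v₀.1 s)).ncard : ℝ) ^ (ω / 3) := by
      rw [ncard_piPattern, Nat.cast_prod]
      exact Real.finsetProd_rpow _ _ (fun _ _ => Nat.cast_nonneg _) _
    have hne' : (piPattern fun s => Λ (v₀.1 s)).Nonempty := by
      choose q hq using fun s => hΛ (v₀.1 s)
      exact ⟨(fun s => (q s).1, fun s => (q s).2.1, fun s => (q s).2.2), hq⟩
    let s : (Fin N → I) × (Fin N → J) → (Fin N → J) × (Fin N → K) →
        (Fin N → K) × (Fin N → I) → F := fun x y z =>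
      ∏ n, t (v₀.1 n, x.1 n, x.2 n) (v₀.1 n, y.1 n, y.2 n) (v₀.1 n, z.1 n, z.2 n)
    have hs : ∀ x y z, s x y z ≠ 0 ↔ (x, y, z) ∈ pmmSupport (piPattern fun s => Λ (v₀.1 s)) := by
      rintro ⟨i, j⟩ ⟨j', k⟩ ⟨k', i'⟩
      simp only [s, ne_eq, Finset.prod_eq_zero_iff, Finset.mem_univ, true_and, not_exists]
      rw [mem_pmmSupport]
      have : ∀ n, ¬ t (v₀.1 n, i n, j n) (v₀.1 n, j' n, k n) (v₀.1 n, k' n, i' n) = 0 ↔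
          j n = j' n ∧ k n = k' n ∧ i' n = i n ∧ (i n, j n, k n) ∈ Λ (v₀.1 n) := by
        intro n
        rw [← ne_eq, hsupp]
        simp only [sumSupport, Set.mem_ofPred_eq, true_and, mem_pmmSupport]
      simp only [this, forall_and, funext_iff, piPattern, Set.mem_ofPred_eq]
    have hrank : RankLE (copies {v // type v = τ} s) (r ^ N) := by
      have h1 := (ht.prod (n := N)).comap
        (fun (x : {v // type v = τ} × (Fin N → I) × (Fin N → J)) n =>
          (x.1.1 n, x.2.1 (σ x.1 n), x.2.2 (σ x.1 n)))
        (fun (y : {v // type v = τ} × (Fin N → J) × (Fin N → K)) n =>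
          (y.1.1 n, y.2.1 (σ y.1 n), y.2.2 (σ y.1 n)))
        (fun (z : {v // type v = τ} × (Fin N → K) × (Fin N → I)) n =>
          (z.1.1 n, z.2.1 (σ z.1 n), z.2.2 (σ z.1 n)))
      convert h1 using 1
      funext ⟨v, x⟩ ⟨v', y⟩ ⟨v'', z⟩
      simp only [copies]
      split_ifs with hv
      · obtain ⟨rfl, rfl⟩ := hv
        simp only [s, ← hσ v]
        exact (Equiv.prod_comp (σ v) fun n => t (v₀.1 n, x.1 n, x.2 n) (v₀.1 n, y.1 n, y.2 n)
          (v₀.1 n, z.1 n, z.2 n)).symm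
      · symm
        by_contra h0
        apply hv
        have h2 : ∀ n, v.1 n = v'.1 n ∧ v'.1 n = v''.1 n := by
          intro n
          have h3 := (hsupp _ _ _).1 (Finset.prod_ne_zero_iff.1 h0 n (Finset.mem_univ n))
          exact ⟨h3.1, h3.2.1⟩
        exact ⟨Subtype.ext (funext fun n => (h2 n).1), Subtype.ext (funext fun n => (h2 n).2)⟩
    have := card_mul_rpow_le_of_copies hne' hs hrank
    simp only [hf]
    rw [Finset.sum_const, nsmul_eq_mul, Finset.card_univ, hcard]
    exact_mod_cast this
  have hsplit : (∑ w, ((Λ w).ncard : ℝ) ^ (ω / 3)) ^ N = ∑ τ, ∑ v : {v // type v = τ}, f v := by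
    rw [Finset.sum_pow', Fintype.piFinset_univ, ← Fintype.sum_fiberwise type]
  rw [hsplit]
  calc ∑ τ, ∑ v : {v // type v = τ}, f v ≤ ∑ _τ : P → Fin (N + 1), 2 * (r : ℝ) ^ N :=
        Finset.sum_le_sum fun τ _ => hclass τ
    _ = ((N : ℝ) + 1) ^ p * (2 * (r : ℝ) ^ N) := by simp [p]
    _ ≤ (2 * (N : ℝ)) ^ p * (2 * (r : ℝ) ^ N) := by
        have : (1 : ℝ) ≤ N := by exact_mod_cast hN
        gcongr
        linarith
    _ = _ := by ring

end DirectSum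

theorem asymptotic_sum_inequality
    (F : Type*) [Field F] [Infinite F]
    (p : ℕ) (hp : 0 < p)
    (I J K : Fin p → Type*)
    [∀ i, Fintype (I i)] [∀ i, Fintype (J i)] [∀ i, Fintype (K i)]
    (Λ : ∀ i, Set (I i × J i × K i)) (hΛ : ∀ i, (Λ i).Nonempty) :
    ∑ i, ((Λ i).ncard : ℝ) ^ (omegaS F 1 1 1 / 3) ≤
      AsymptoticSupportRank F (FamPMMSumSupport Λ) := by
  classical
  refine le_csInf ⟨_, 1, one_pos, rfl⟩ ?_
  rintro _ ⟨n, hn, rfl⟩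
  set ω := omegaS F 1 1 1
  set r := SupportRank F (PowSupport (FamPMMSumSupport Λ) n)
  let ι : ∀ w, I w × J w × K w → (Σ i, I i) × (Σ i, J i) × (Σ i, K i) :=
    fun w q => (⟨w, q.1⟩, ⟨w, q.2.1⟩, ⟨w, q.2.2⟩)
  have hι : ∀ w, Function.Injective (ι w) := by
    rintro w ⟨x, y, z⟩ ⟨x', y', z'⟩ h
    simpa [ι] using h
  have himage := (suppRankLE_supportRank (F := F) (PowSupport (FamPMMSumSupport Λ) n)).image
    (fun x : Fin n → Σ i, I i × J i => (fun s => (x s).1,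
      (fun s => (⟨(x s).1, (x s).2.1⟩ : Σ i, I i)), fun s => (⟨(x s).1, (x s).2.2⟩ : Σ i, J i)))
    (fun y : Fin n → Σ i, J i × K i => (fun s => (y s).1,
      (fun s => (⟨(y s).1, (y s).2.1⟩ : Σ i, J i)), fun s => (⟨(y s).1, (y s).2.2⟩ : Σ i, K i)))
    (fun z : Fin n → Σ i, K i × I i => (fun s => (z s).1,
      (fun s => (⟨(z s).1, (z s).2.1⟩ : Σ i, K i)), fun s => (⟨(z s).1, (z s).2.2⟩ : Σ i, I i)))
  have hsum : SuppRankLE F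
      (sumSupport fun w : Fin n → Fin p => piPattern fun s => ι (w s) '' Λ (w s)) r := by
    convert himage using 1
    ext ⟨⟨w, i, j⟩, ⟨w', j', k⟩, ⟨w'', k', i'⟩⟩
    simp only [sumSupport, Set.mem_ofPred_eq, mem_pmmSupport, piPattern, Set.mem_image]
    constructor
    · rintro ⟨rfl, rfl, rfl, rfl, rfl, h⟩
      choose q hq hqe using h
      refine ⟨(fun s => ⟨w s, (q s).1, (q s).2.1⟩, fun s => ⟨w s, (q s).2.1, (q s).2.2⟩,
        fun s => ⟨w s, (q s).2.2, (q s).1⟩), fun s => ⟨w s, _, _, _, hq s, rfl⟩, ?_⟩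
      simp only [ι, Prod.mk.injEq] at hqe
      simp only [Prod.map_apply, Prod.mk.injEq, true_and, funext_iff]
      exact ⟨⟨fun s => (hqe s).1, fun s => (hqe s).2.1⟩, ⟨fun s => (hqe s).2.1,
        fun s => (hqe s).2.2⟩, fun s => (hqe s).2.2, fun s => (hqe s).1⟩
    · rintro ⟨⟨x, y, z⟩, h, heq⟩
      choose u a b c hΛu hq using h
      simp only [Prod.mk.injEq] at hq
      obtain rfl : x = fun s => ⟨u s, a s, b s⟩ := funext fun s => (hq s).1
      obtain rfl : y = fun s => ⟨u s, b s, c s⟩ := funext fun s => (hq s).2.1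
      obtain rfl : z = fun s => ⟨u s, c s, a s⟩ := funext fun s => (hq s).2.2
      simp only [Prod.map_apply, Prod.mk.injEq] at heq
      obtain ⟨⟨rfl, rfl, rfl⟩, ⟨rfl, rfl, rfl⟩, rfl, rfl, rfl⟩ := heq
      exact ⟨rfl, rfl, rfl, rfl, rfl, fun s => ⟨(a s, b s, c s), hΛu s, rfl⟩⟩
  have hle := sum_rpow_le_of_sumSupport (fun w => by
    choose q hq using fun s => hΛ (w s)
    exact ⟨(fun s => (ι (w s) (q s)).1, fun s => (ι (w s) (q s)).2.1,
      fun s => (ι (w s) (q s)).2.2), fun s => ⟨q s, hq s, rfl⟩⟩) hsum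
  have hpow : (∑ i, ((Λ i).ncard : ℝ) ^ (ω / 3)) ^ n ≤ r := by
    rw [Finset.sum_pow', Fintype.piFinset_univ]
    refine le_trans (Finset.sum_le_sum fun w _ => ?_) hle
    rw [ncard_piPattern, Nat.cast_prod, Real.finsetProd_rpow _ _ fun _ _ => by positivity]
    simp only [Set.ncard_image_of_injective _ (hι _)]
    exact le_rfl
  rw [one_div]
  refine (Real.le_rpow_inv_iff_of_pos (by positivity) (by positivity) (by positivity)).2 ?_
  rwa [Real.rpow_natCast]
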